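/- arXiv:math/0505436 — 2 statements merged into one kernel-verified Lean document; each statement's English description precedes it below -/
import Mathlib

section
/- For all positive integers r and n, in the polynomial ring ℤ[q] one has ∑_{σ ∈ G_{r,n}} q^{exc^Clr(σ)} (−1)^{cyc(σ)} = −(q^r − 1)^{n−1} · [r]_q (equivalently, (q−1)·∑_{σ ∈ G_{r,n}} q^{exc^Clr(σ)}(−1)^{cyc(σ)} = −(q^r − 1)^n). -/
open Finset Polynomial

/-- Number of excedances of a permutation: #{i : τ(i) > i}. -/
def exc {n : ℕ} (τ : Equiv.Perm (Fin n)) : ℕ :=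
  (Finset.univ.filter fun i => i < τ i).card

/-- Number of cycles of a permutation, counting fixed points as cycles. -/
def cyc {n : ℕ} (τ : Equiv.Perm (Fin n)) : ℕ :=
  Multiset.card τ.cycleType + (Finset.univ.filter fun i => τ i = i).card

/-- Color sum of a colored permutation. -/
def csum {r n : ℕ} (z : Fin n → Fin r) : ℕ := ∑ i, (z i : ℕ)

/-- #{i : z_i = 0 and τ(i) > i}. -/
def excA {r n : ℕ} (z : Fin n → Fin r) (τ : Equiv.Perm (Fin n)) : ℕ :=
  (Finset.univ.filter fun i => (z i : ℕ) = 0 ∧ i < τ i).card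

/-- Excedance number with respect to the absolute order. -/
def excAbs {r n : ℕ} (z : Fin n → Fin r) (τ : Equiv.Perm (Fin n)) : ℕ :=
  exc τ + csum z

/-- Excedance number with respect to the color order. -/
def excClr {r n : ℕ} (z : Fin n → Fin r) (τ : Equiv.Perm (Fin n)) : ℕ :=
  r * excA z τ + csum z

/-- The sign of a permutation determines the parity of its number of cycles. -/
theorem neg_one_pow_cyc {n : ℕ} (R : Type*) [CommRing R] (τ : Equiv.Perm (Fin n)) :
    (-1 : R) ^ cyc τ = (-1) ^ n * ((Equiv.Perm.sign τ : ℤ) : R) := by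
  have hsplit : τ.cycleType.sum + (univ.filter fun i => τ i = i).card = n := by
    have h := card_filter_add_card_filter_not (s := (univ : Finset (Fin n))) (fun i => τ i = i)
    rw [card_univ, Fintype.card_fin] at h
    rw [Equiv.Perm.sum_cycleType, Equiv.Perm.support, add_comm]
    exact h
  have hsq : (-1 : R) ^ τ.cycleType.sum * (-1) ^ τ.cycleType.sum = 1 := by
    rw [← mul_pow]
    simp
  rw [Equiv.Perm.sign_of_cycleType, cyc]
  have hn : (-1 : R) ^ n = (-1) ^ τ.cycleType.sum * (-1) ^ (univ.filter fun i => τ i = i).card := by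
    rw [← pow_add, hsplit]
  rw [hn]
  push_cast
  simp only [pow_add]
  linear_combination (-(-1 : R) ^ Multiset.card τ.cycleType *
    (-1) ^ (univ.filter fun i => τ i = i).card) * hsq

/-- The determinant of the matrix with entries `q` strictly above the diagonal and `1` elsewhere. -/
theorem det_ite_lt {R : Type*} [CommRing R] (q : R) (m : ℕ) :
    (Matrix.of fun i j : Fin (m + 1) => if i < j then q else 1).det = (1 - q) ^ m := by
  let B : Matrix (Fin (m + 1)) (Fin (m + 1)) R :=
    Matrix.of (Fin.cons (fun j => if 0 < j then q else 1)
      (fun (i : Fin m) j => if j = i.succ then 1 - q else 0))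
  have hB : B.det = (1 - q) ^ m := by
    rw [Matrix.det_of_isUpperTriangular, Fin.prod_univ_succ]
    · simp [B]
    · intro i j hij
      induction i using Fin.cases with
      | zero => exact absurd hij (Fin.not_lt_zero _)
      | succ i =>
        have : j ≠ i.succ := ne_of_lt hij
        simp [B, this]
  rw [← hB]
  refine Matrix.det_eq_of_forall_row_eq_smul_add_pred (fun _ => 1) (fun j => by simp [B]) ?_
  intro i j
  simp only [B, Matrix.of_apply, Fin.cons_succ, one_mul, Fin.lt_def, Fin.ext_iff, Fin.val_succ,
    Fin.val_castSucc]
  split_ifs <;> first | omega | ring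

/-- The sum over the colors of a single letter, which is an excedance iff `p` holds. -/
theorem sum_color_weight {R : Type*} [CommRing R] (q : R) {r : ℕ} (hr : 0 < r) (p : Prop)
    [Decidable p] :
    ∑ c : Fin r, q ^ (r * (if (c : ℕ) = 0 ∧ p then 1 else 0) + (c : ℕ)) =
      (∑ i ∈ range r, q ^ i) * if p then q else 1 := by
  rw [Fin.sum_univ_eq_sum_range (fun c => q ^ (r * (if c = 0 ∧ p then 1 else 0) + c))]
  obtain ⟨s, rfl⟩ := Nat.exists_eq_succ_of_ne_zero hr.ne'
  by_cases hp : p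
  · rw [sum_range_succ']
    simp only [hp, and_true, if_true, sum_mul, ← pow_succ]
    rw [sum_range_succ (fun i => q ^ (i + 1))]
    simp
  · simp [hp]

/-- The generating function of `excClr` over all colorings of a fixed permutation. -/
theorem sum_pow_excClr {R : Type*} [CommRing R] (q : R) {r n : ℕ} (hr : 0 < r)
    (τ : Equiv.Perm (Fin n)) :
    ∑ z : Fin n → Fin r, q ^ excClr z τ =
      (∑ i ∈ range r, q ^ i) ^ n * ∏ i, if i < τ i then q else 1 := by
  have hz (z : Fin n → Fin r) : q ^ excClr z τ =
      ∏ i, q ^ (r * (if (z i : ℕ) = 0 ∧ i < τ i then 1 else 0) + (z i : ℕ)) := by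
    rw [prod_pow_eq_pow_sum, sum_add_distrib, ← mul_sum, ← card_filter]
    rfl
  simp only [hz]
  rw [← Fintype.prod_sum
    (fun i (c : Fin r) => q ^ (r * (if (c : ℕ) = 0 ∧ i < τ i then 1 else 0) + (c : ℕ)))]
  simp only [sum_color_weight q hr, prod_mul_distrib, prod_const, card_univ, Fintype.card_fin]

theorem stmt1 (r n : ℕ) (hr : 0 < r) (hn : 0 < n) :
    ∑ σ : (Fin n → Fin r) × Equiv.Perm (Fin n),
      (X : Polynomial ℤ) ^ excClr σ.1 σ.2 * (-1) ^ cyc σ.2 =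
    -((X : Polynomial ℤ) ^ r - 1) ^ (n - 1) * ∑ i ∈ Finset.range r, (X : Polynomial ℤ) ^ i := by
  obtain ⟨m, rfl⟩ := Nat.exists_eq_add_one_of_ne_zero hn.ne'
  have hdet := det_ite_lt (X : Polynomial ℤ) m
  rw [← Matrix.det_transpose, Matrix.det_apply'] at hdet
  simp only [Matrix.transpose_apply, Matrix.of_apply] at hdet
  rw [Fintype.sum_prod_type_right]
  simp only [← sum_mul, sum_pow_excClr _ hr, neg_one_pow_cyc]
  calc
    _ = (-1) ^ (m + 1) * (∑ i ∈ range r, (X : Polynomial ℤ) ^ i) ^ (m + 1) * (1 - X) ^ m := by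
      rw [← hdet, mul_sum]
      exact sum_congr rfl fun τ _ => by ring
    _ = _ := by
      rw [← geom_sum_mul, ← neg_sub X 1, neg_pow (X - 1 : Polynomial ℤ) m, Nat.add_sub_cancel,
        mul_pow, pow_succ (-1 : Polynomial ℤ)]
      have hsq : (-1 : Polynomial ℤ) ^ m * (-1) ^ m = 1 := by
        rw [← mul_pow]
        simp
      linear_combination (-(∑ i ∈ range r, (X : Polynomial ℤ) ^ i) ^ (m + 1) * (X - 1) ^ m) * hsq
end

section
/- For every positive integer r and every integer n ≥ 2, in ℤ[q] one has ∑_{σ ∈ D_{r,n}} q^{exc^Clr(σ)} (−1)^{cyc(σ)} = [r]_q · ( ∑_{σ ∈ D_{r,n−1}} q^{exc^Clr(σ)} (−1)^{cyc(σ)} − q^{n−1} [r]_q^{n−1} ), where the sums are over derangements. -/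
open Finset Polynomial

/-- The matrix with `q` above the diagonal, `1` below, and diagonal `(x, 0, …, 0)`. -/
def excMatrix {R : Type*} [CommRing R] (q x : R) (n : ℕ) : Matrix (Fin n) (Fin n) R :=
  Matrix.of fun i j => if i < j then q else if j < i then 1 else if (i : ℕ) = 0 then x else 0

theorem det_excMatrix_add_two {R : Type*} [CommRing R] (q x : R) (n : ℕ) :
    (excMatrix q x (n + 2)).det =
      (x - 1) * (excMatrix q 0 (n + 1)).det - q * (excMatrix q 1 (n + 1)).det := by
  have h01 : (0 : Fin (n + 2)) ≠ 1 := by simp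
  rw [← Matrix.det_updateRow_add_smul_self (excMatrix q x (n + 2)) h01 (-1),
    Matrix.det_succ_row_zero, Fin.sum_univ_succ, Fin.sum_univ_succ, Finset.sum_eq_zero]
  · have e0 : ((excMatrix q x (n + 2)).updateRow 0 (excMatrix q x (n + 2) 0 +
        (-1 : R) • excMatrix q x (n + 2) 1)).submatrix Fin.succ (Fin.succAbove 0) =
        excMatrix q 0 (n + 1) := by
      ext i j
      simp [Matrix.updateRow_apply, excMatrix]
    have e1 : ((excMatrix q x (n + 2)).updateRow 0 (excMatrix q x (n + 2) 0 +
        (-1 : R) • excMatrix q x (n + 2) 1)).submatrix Fin.succ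
          (Fin.succAbove (Fin.succ 0)) = excMatrix q 1 (n + 1) := by
      ext i j
      refine Fin.cases ?_ (fun j => ?_) j
      · refine Fin.cases ?_ (fun i => ?_) i <;>
          simp [Matrix.updateRow_apply, excMatrix, Fin.succAbove]
      · have hj : (Fin.succ 0 : Fin (n + 2)).succAbove j.succ = j.succ.succ := by
          simp [Fin.succAbove, Fin.lt_def]
        simp only [Matrix.submatrix_apply, hj]
        have h1j : (1 : Fin (n + 2)) < j.succ.succ := by simp [Fin.lt_def]
        refine Fin.cases ?_ (fun i => ?_) i <;> simp [Matrix.updateRow_apply, excMatrix, h1j]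
    rw [e0, e1]
    simp [excMatrix]
    ring
  · intro j _
    have h : (1 : Fin (n + 2)) < j.succ.succ := by simp [Fin.lt_def]
    simp [excMatrix, h]

theorem det_excMatrix_one {R : Type*} [CommRing R] (q : R) (n : ℕ) :
    (excMatrix q 1 (n + 1)).det = (-q) ^ n := by
  induction n with
  | zero => simp [excMatrix]
  | succ n ih => rw [det_excMatrix_add_two, ih]; ring

theorem neg_one_pow_cyc_of_derangement {R : Type*} [CommRing R] {n : ℕ}
    (τ : Equiv.Perm (Fin n)) (h : ∀ i, τ i ≠ i) :
    (-1 : R) ^ cyc τ = (-1) ^ n * ((Equiv.Perm.sign τ : ℤ) : R) := by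
  have hs : τ.support = univ := by ext i; simp [h i]
  have hf : (univ.filter fun i => τ i = i) = ∅ := by ext i; simp [h i]
  rw [Equiv.Perm.sign_of_cycleType, Equiv.Perm.sum_cycleType, hs, cyc, hf]
  push_cast
  rw [Finset.card_univ, Fintype.card_fin, pow_add, pow_add, ← mul_assoc, ← mul_pow]
  simp

theorem det_excMatrix_zero {R : Type*} [CommRing R] (q : R) (n : ℕ) :
    (-1) ^ n * (excMatrix q 0 n).det =
      ∑ τ ∈ univ.filter (fun τ : Equiv.Perm (Fin n) => ∀ i, τ i ≠ i),
        q ^ exc τ * (-1) ^ cyc τ := by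
  rw [← Matrix.det_transpose, Matrix.det_apply', Finset.mul_sum, Finset.sum_filter]
  refine Finset.sum_congr rfl fun τ _ => ?_
  split_ifs with h
  · rw [neg_one_pow_cyc_of_derangement τ h, exc, ← Finset.prod_const, Finset.prod_filter]
    have : ∀ i, (excMatrix q 0 n).transpose (τ i) i = if i < τ i then q else 1 := by
      intro i
      rcases lt_or_gt_of_ne (h i) with h' | h' <;> simp [excMatrix, h', h'.not_gt]
    simp only [this]
    ring
  · push Not at h
    obtain ⟨i, hi⟩ := h
    rw [Finset.prod_eq_zero (Finset.mem_univ i)] <;> simp [excMatrix, hi]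

theorem sum_derangements_succ {R : Type*} [CommRing R] (q : R) (n : ℕ) :
    (∑ τ ∈ univ.filter (fun τ : Equiv.Perm (Fin (n + 2)) => ∀ i, τ i ≠ i),
        q ^ exc τ * (-1) ^ cyc τ) =
      (∑ τ ∈ univ.filter (fun τ : Equiv.Perm (Fin (n + 1)) => ∀ i, τ i ≠ i),
        q ^ exc τ * (-1) ^ cyc τ) - q ^ (n + 1) := by
  have hq : (-1 : R) ^ n * (-q) ^ n = q ^ n := by rw [← mul_pow]; simp
  rw [← det_excMatrix_zero, ← det_excMatrix_zero, det_excMatrix_add_two, det_excMatrix_one]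
  linear_combination (-q) * hq

theorem sum_colors_pow_excClr {R : Type*} [CommRing R] (q : R) {r n : ℕ} (hr : 0 < r)
    (τ : Equiv.Perm (Fin n)) :
    ∑ z : Fin n → Fin r, q ^ excClr z τ =
      (∑ i ∈ Finset.range r, q ^ i) ^ n * q ^ exc τ := by
  have hz : ∀ z : Fin n → Fin r, q ^ excClr z τ =
      ∏ i, (if (z i : ℕ) = 0 ∧ i < τ i then q ^ r else 1) * q ^ (z i : ℕ) := by
    intro z
    rw [Finset.prod_mul_distrib, Finset.prod_pow_eq_pow_sum, ← Finset.prod_filter,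
      Finset.prod_const, ← pow_mul, ← pow_add]
    rfl
  have hi : ∀ i : Fin n,
      (∑ c : Fin r, (if (c : ℕ) = 0 ∧ i < τ i then q ^ r else 1) * q ^ (c : ℕ)) =
        (∑ k ∈ Finset.range r, q ^ k) * if i < τ i then q else 1 := by
    intro i
    rw [Fin.sum_univ_eq_sum_range
      (fun c => (if c = 0 ∧ i < τ i then q ^ r else 1) * q ^ c) r]
    obtain ⟨m, rfl⟩ := Nat.exists_eq_succ_of_ne_zero hr.ne'
    split_ifs with h
    · rw [Finset.sum_range_succ', Finset.sum_range_succ, add_mul, Finset.sum_mul]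
      simp [h, pow_succ]
    · simp [h]
  simp only [hz]
  rw [← Fintype.prod_sum (fun (i : Fin n) (c : Fin r) =>
    (if (c : ℕ) = 0 ∧ i < τ i then q ^ r else 1) * q ^ (c : ℕ))]
  simp only [hi]
  rw [Finset.prod_mul_distrib, Finset.prod_const, ← Finset.prod_filter, Finset.prod_const]
  simp [exc]

theorem sum_colored_derangements {R : Type*} [CommRing R] (q : R) {r : ℕ} (n : ℕ) (hr : 0 < r) :
    ∑ σ ∈ univ.filter
        (fun σ : (Fin n → Fin r) × Equiv.Perm (Fin n) => ∀ i, σ.2 i ≠ i),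
      q ^ excClr σ.1 σ.2 * (-1) ^ cyc σ.2 =
    (∑ i ∈ Finset.range r, q ^ i) ^ n *
      ∑ τ ∈ univ.filter (fun τ : Equiv.Perm (Fin n) => ∀ i, τ i ≠ i),
        q ^ exc τ * (-1) ^ cyc τ := by
  rw [Finset.sum_filter, Fintype.sum_prod_type_right, Finset.sum_filter, Finset.mul_sum]
  refine Finset.sum_congr rfl fun τ _ => ?_
  split_ifs with h
  · dsimp only
    rw [← Finset.sum_mul, sum_colors_pow_excClr q hr]
    ring
  · simp

theorem stmt7 (r n : ℕ) (hr : 0 < r) (hn : 2 ≤ n) :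
    ∑ σ ∈ Finset.univ.filter
        (fun σ : (Fin n → Fin r) × Equiv.Perm (Fin n) => ∀ i, σ.2 i ≠ i),
      (X : Polynomial ℤ) ^ excClr σ.1 σ.2 * (-1) ^ cyc σ.2 =
    (∑ i ∈ Finset.range r, (X : Polynomial ℤ) ^ i) *
      ((∑ σ ∈ Finset.univ.filter
          (fun σ : (Fin (n - 1) → Fin r) × Equiv.Perm (Fin (n - 1)) => ∀ i, σ.2 i ≠ i),
        (X : Polynomial ℤ) ^ excClr σ.1 σ.2 * (-1) ^ cyc σ.2) -
       (X : Polynomial ℤ) ^ (n - 1) * (∑ i ∈ Finset.range r, (X : Polynomial ℤ) ^ i) ^ (n - 1)) := by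
  obtain ⟨m, rfl⟩ := Nat.exists_eq_add_of_le' hn
  rw [sum_colored_derangements _ _ hr, sum_colored_derangements _ _ hr,
    sum_derangements_succ, show m + 2 - 1 = m + 1 from rfl]
  ring
end
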